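/- (Induction step of the completeness proof for Policy Descent Tree search) Let M be a finite MDP, let π* be an optimal policy for M, and let π' be any policy that differs from π* on a nonempty set D = { s : π'(s) ≠ π*(s) } of states. Then there exists a state s ∈ D such that the policy π obtained from π' by replacing its action at s with π*(s) (and keeping π' elsewhere) satisfies V^π_M(s'') ≥ V^{π'}_M(s'') for all states s''. -/

import Mathlib

open Finset

/-- A finite MDP with state space `S` and action space `A`:
transition probabilities `T`, rewards `R`, discount factor `γ ∈ [0,1)`. -/
structure MDP (S A : Type) [Fintype S] [Fintype A] where
  T : S → A → S → ℝ
  R : S → A → ℝ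
  γ : ℝ
  T_nonneg : ∀ s a s', 0 ≤ T s a s'
  T_sum_one : ∀ s a, ∑ s' : S, T s a s' = 1
  γ_nonneg : 0 ≤ γ
  γ_lt_one : γ < 1

variable {S A : Type} [Fintype S] [Fintype A]

/-- `V` assigns to each stationary deterministic policy its value function,
i.e. a solution of the Bellman equations (unique since `γ < 1`). -/
def IsValue (M : MDP S A) (V : (S → A) → S → ℝ) : Prop :=
  ∀ π : S → A, ∀ s : S, V π s = M.R s (π s) + M.γ * ∑ s' : S, M.T s (π s) s' * V π s'

/-- The Q-function `Q^π_M(s,a)` induced by the value function `V`. -/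
def Qf (M : MDP S A) (V : (S → A) → S → ℝ) (π : S → A) (s : S) (a : A) : ℝ :=
  M.R s a + M.γ * ∑ s' : S, M.T s a s' * V π s'

/-- `πstar` is an optimal policy for `M`. -/
def IsOptimal (M : MDP S A) (V : (S → A) → S → ℝ) (πstar : S → A) : Prop :=
  ∀ π : S → A, ∀ s : S, V π s ≤ V πstar s

/-- Minimum principle: a function dominating its discounted average is nonnegative. -/
theorem MDP.nonneg_of_discounted_average_le (M : MDP S A) (π : S → A) (f : S → ℝ)
    (hf : ∀ s, M.γ * ∑ s', M.T s (π s) s' * f s' ≤ f s) (s : S) : 0 ≤ f s := by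
  obtain ⟨m, -, hm⟩ := Finset.exists_min_image Finset.univ f ⟨s, Finset.mem_univ s⟩
  have havg : f m ≤ ∑ s', M.T m (π m) s' * f s' :=
    calc f m = ∑ s', M.T m (π m) s' * f m := by
          rw [← Finset.sum_mul, M.T_sum_one, one_mul]
      _ ≤ _ := Finset.sum_le_sum fun s' _ =>
          mul_le_mul_of_nonneg_left (hm s' (Finset.mem_univ s')) (M.T_nonneg _ _ _)
  have hmin := (mul_le_mul_of_nonneg_left havg M.γ_nonneg).trans (hf m)
  have hnonneg : 0 ≤ f m := by nlinarith [M.γ_lt_one]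
  exact hnonneg.trans (hm s (Finset.mem_univ s))

theorem Qf_sub_Qf (M : MDP S A) (V : (S → A) → S → ℝ) (π₁ π₂ : S → A) (s : S) (a : A) :
    Qf M V π₁ s a - Qf M V π₂ s a = M.γ * ∑ s', M.T s a s' * (V π₁ s' - V π₂ s') := by
  simp only [Qf, mul_sub, Finset.sum_sub_distrib]
  ring

/-- Policy improvement. -/
theorem IsValue.le_of_le_Qf {M : MDP S A} {V : (S → A) → S → ℝ} (hV : IsValue M V)
    {π₁ π₂ : S → A} (h : ∀ s, V π₁ s ≤ Qf M V π₁ s (π₂ s)) (s : S) : V π₁ s ≤ V π₂ s := by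
  refine sub_nonneg.mp (M.nonneg_of_discounted_average_le π₂ (fun s => V π₂ s - V π₁ s) ?_ s)
  intro s
  rw [← Qf_sub_Qf]
  have hs : V π₂ s = Qf M V π₂ s (π₂ s) := hV π₂ s
  linarith [h s]

/-- Replacing actions by ones that are no better for `π₁` gives no better policy. -/
theorem IsValue.le_of_Qf_le {M : MDP S A} {V : (S → A) → S → ℝ} (hV : IsValue M V)
    {π₁ π₂ : S → A} (h : ∀ s, Qf M V π₁ s (π₂ s) ≤ V π₁ s) (s : S) : V π₂ s ≤ V π₁ s := by
  refine sub_nonneg.mp (M.nonneg_of_discounted_average_le π₂ (fun s => V π₁ s - V π₂ s) ?_ s)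
  intro s
  rw [← Qf_sub_Qf]
  have hs : V π₂ s = Qf M V π₂ s (π₂ s) := hV π₂ s
  linarith [h s]

/-- induction step of the PDT completeness proof: if `π'` differs from an
optimal policy `π*` somewhere, then there is a state `s` where they differ such that
replacing `π'(s)` by `π*(s)` yields a policy that is everywhere no worse than `π'`. -/
theorem pdt_induction_step
    [Nonempty S] [Nonempty A] [DecidableEq S]
    (M : MDP S A) (V : (S → A) → S → ℝ) (hV : IsValue M V)
    (πstar : S → A) (hopt : IsOptimal M V πstar)
    (π' : S → A) (hne : ∃ s : S, π' s ≠ πstar s) :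
    ∃ s : S, π' s ≠ πstar s ∧
      ∀ s'' : S, V (Function.update π' s (πstar s)) s'' ≥ V π' s'' := by
  have himp : ∃ s, π' s ≠ πstar s ∧ V π' s ≤ Qf M V π' s (πstar s) := by
    by_contra! hlt
    have hle : ∀ s, Qf M V π' s (πstar s) ≤ V π' s := fun s => by
      by_cases hs : π' s = πstar s
      · rw [← hs]
        exact (hV π' s).ge
      · exact (hlt s hs).le
    have heq : V π' = V πstar := funext fun s => (hopt π' s).antisymm (hV.le_of_Qf_le hle s)
    obtain ⟨s, hs⟩ := hne
    have hlt_s := hlt s hs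
    rw [Qf, heq, ← hV πstar s] at hlt_s
    exact lt_irrefl _ hlt_s
  obtain ⟨s, hs, hQ⟩ := himp
  refine ⟨s, hs, hV.le_of_le_Qf fun t => ?_⟩
  by_cases ht : t = s
  · subst ht
    rwa [Function.update_self]
  · rw [Function.update_of_ne ht]
    exact (hV π' t).le
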